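/- For every φ ∈ 𝒪¹(ℂ̄∖[0,1]): (i) for every compact subset K of ℂ∖[0,1], Σ_{g∈ℳ} sup_{z∈K} |(L_g φ)(z)| < ∞, so the family (L_g φ)_{g∈ℳ} is summable, uniformly on compact subsets of ℂ∖[0,1], and its sum Σ_ℳ φ belongs to 𝒪¹(ℂ̄∖[0,1]); (ii) Σ_ℳ φ(z) = Σ_{r≥0} (T^r φ)(z) for every z ∈ ℂ∖[0,1]; (iii) Σ_ℳ φ − T(Σ_ℳ φ) = φ and Σ_ℳ(φ − Tφ) = φ, i.e. Σ_ℳ and (1 − T) are mutually inverse on 𝒪¹(ℂ̄∖[0,1]). -/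

import Mathlib

open Complex Filter Set Topology
open scoped ENNReal NNReal

noncomputable section

/-- The complement in `ℂ` of the real segment `[a, b]`. -/
def cutPlane (a b : ℝ) : Set ℂ := (Complex.ofReal '' Set.Icc a b)ᶜ

/-- `𝒪¹(ℂ̄ ∖ [a,b])`: holomorphic on `ℂ ∖ [a,b]`, vanishing at infinity. -/
def O1 (a b : ℝ) : Set (ℂ → ℂ) :=
  {φ | DifferentiableOn ℂ φ (cutPlane a b) ∧
       Tendsto φ (Bornology.cobounded ℂ) (nhds 0)}

/-- `𝒪³(ℂ̄ ∖ [a,b])`: holomorphic on `ℂ ∖ [a,b]`, with `z²ψ(z) → 0` at infinity. -/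
def O3 (a b : ℝ) : Set (ℂ → ℂ) :=
  {ψ | DifferentiableOn ℂ ψ (cutPlane a b) ∧
       Tendsto (fun z => z ^ 2 * ψ z) (Bornology.cobounded ℂ) (nhds 0)}

/-- The `m`-th term (for the integer `m+1 ≥ 1`) of the series defining `T`. -/
def Tterm (φ : ℂ → ℂ) (m : ℕ) (z : ℂ) : ℂ :=
  -z * (φ (z⁻¹ - ((m : ℂ) + 1)) - φ (-((m : ℂ) + 1))) + deriv φ (-((m : ℂ) + 1))

/-- The operator `T`. -/
def Tbrj (φ : ℂ → ℂ) : ℂ → ℂ := fun z => ∑' m : ℕ, Tterm φ m z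

/-- The operator `T⁽³⁾`. -/
def T3brj (ψ : ℂ → ℂ) : ℂ → ℂ := fun z => -∑' m : ℕ, (z⁻¹) ^ 3 * ψ (z⁻¹ - ((m : ℂ) + 1))

/-- `g(m) = (0 1; 1 m)`. -/
def gmat (m : ℤ) : Matrix (Fin 2) (Fin 2) ℤ := !![0, 1; 1, m]

/-- The monoid `ℳ`. -/
def Mmon : Set (Matrix (Fin 2) (Fin 2) ℤ) :=
  {g | g = 1 ∨
    ((g 0 0 * g 1 1 - g 0 1 * g 1 0 = 1 ∨ g 0 0 * g 1 1 - g 0 1 * g 1 0 = -1) ∧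
      g 0 1 ≤ g 1 1 ∧ g 0 0 ≤ g 0 1 ∧ 0 ≤ g 0 0 ∧ g 1 0 ≤ g 1 1 ∧ g 0 0 ≤ g 1 0)}

/-- The operator `L_g` on `𝒪¹(ℂ̄ ∖ [0,1])`, for `g = (a b; c d) ∈ ℳ`. -/
def Lop (g : Matrix (Fin 2) (Fin 2) ℤ) (φ : ℂ → ℂ) : ℂ → ℂ := fun z =>
  if g = 1 then φ z
  else
    ((g 0 0 : ℂ) - (g 1 0 : ℂ) * z) *
        (φ (((g 1 1 : ℂ) * z - (g 0 1 : ℂ)) / ((g 0 0 : ℂ) - (g 1 0 : ℂ) * z)) -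
          φ (-(g 1 1 : ℂ) / (g 1 0 : ℂ))) -
      ((g 0 0 * g 1 1 - g 0 1 * g 1 0 : ℤ) : ℂ) * ((g 1 0 : ℂ))⁻¹ *
        deriv φ (-(g 1 1 : ℂ) / (g 1 0 : ℂ))

/-- `Σ_ℳ φ`, the sum of the family `(L_g φ)_{g ∈ ℳ}`. -/
def sumM (φ : ℂ → ℂ) : ℂ → ℂ := fun z => ∑' g : Mmon, Lop g.1 φ z

/-- The domain `D`. -/
def Dset : Set ℂ :=
  {z | ‖z‖ ≤ 1 ∧ 1 ≤ ‖z - Complex.I‖ ∧ 1 ≤ ‖z + Complex.I‖ ∧ 0 < z.re}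

/-- The domain `D₀`. -/
def D0set : Set ℂ := {z | ‖z + 1‖ ≤ 1 ∧ Real.sqrt 3 / 2 - 1 ≤ z.re}

/-- The domain `D₁`. -/
def D1set : Set ℂ :=
  {z | 1 ≤ ‖z‖ ∧ ‖z - (1 / Real.sqrt 3 : ℝ)‖ ≤ 1 / Real.sqrt 3}

/-- The domain `H₀`. -/
def H0set : Set ℂ := {z | ‖z - Complex.I‖ ≤ 1 ∧ 1 ≤ ‖z + 1‖ ∧ z.im ≤ 1 / 2}

/-- The domain `H₀′`. -/
def H0set' : Set ℂ := {z | (starRingEnd ℂ) z ∈ H0set}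

/-- The domain `Δ`. -/
def Δset : Set ℂ := {z | ‖z‖ ≤ 1 ∧ 1 ≤ ‖z + 1‖ ∧ |z.im| ≤ 1 / 2}

/-- The domain `D∞`. -/
def Dinf : Set ℂ :=
  {z | 1 / 2 < |z.im|} ∪ {z | z.re < Real.sqrt 3 / 2 - 1} ∪
    {z | Real.sqrt 3 / 2 < z.re ∧ 1 / Real.sqrt 3 < ‖z - (1 / Real.sqrt 3 : ℝ)‖}

end

lemma Mmon_entries {g : Matrix (Fin 2) (Fin 2) ℤ} (hg : g ∈ Mmon) (h1 : g ≠ 1) :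
    (g 0 0 * g 1 1 - g 0 1 * g 1 0 = 1 ∨ g 0 0 * g 1 1 - g 0 1 * g 1 0 = -1) ∧
      0 ≤ g 0 0 ∧ g 0 0 ≤ g 0 1 ∧ g 0 0 ≤ g 1 0 ∧ g 0 1 ≤ g 1 1 ∧ g 1 0 ≤ g 1 1 ∧
      1 ≤ g 0 1 ∧ 1 ≤ g 1 0 := by
  obtain h | ⟨hdet, hbd, hab, ha, hcd, hac⟩ := hg
  · exact absurd h h1
  have hb : g 0 1 ≠ 0 := by
    intro h
    have : g 0 0 = 0 := by omega
    simp [h, this] at hdet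
  have hc : g 1 0 ≠ 0 := by
    intro h
    have : g 0 0 = 0 := by omega
    simp [h, this] at hdet
  refine ⟨hdet, ha, hab, hac, hbd, hcd, ?_, ?_⟩ <;> omega

lemma matrix_two_ext {g h : Matrix (Fin 2) (Fin 2) ℤ} (h00 : g 0 0 = h 0 0)
    (h01 : g 0 1 = h 0 1) (h10 : g 1 0 = h 1 0) (h11 : g 1 1 = h 1 1) : g = h := by
  ext i j
  fin_cases i <;> fin_cases j <;> assumption

lemma gmat_mul (m : ℤ) (h : Matrix (Fin 2) (Fin 2) ℤ) :
    gmat m * h = !![h 1 0, h 1 1; h 0 0 + m * h 1 0, h 0 1 + m * h 1 1] := by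
  ext i j
  fin_cases i <;> fin_cases j <;> simp [gmat, Matrix.mul_apply, Fin.sum_univ_two]

lemma one_le_Mmon_one_one {g : Matrix (Fin 2) (Fin 2) ℤ} (hg : g ∈ Mmon) : 1 ≤ g 1 1 := by
  by_cases h1 : g = 1
  · simp [h1]
  · obtain ⟨-, -, -, -, h, -, h', -⟩ := Mmon_entries hg h1
    omega

lemma gmat_mul_ne_one {m : ℤ} {h : Matrix (Fin 2) (Fin 2) ℤ} (hh : h ∈ Mmon) :
    gmat m * h ≠ 1 := by
  intro h1
  have h2 := congrFun (congrFun h1 0) 1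
  have := one_le_Mmon_one_one hh
  simp [gmat_mul] at h2
  omega

lemma gmat_mul_mem {m : ℤ} (hm : 1 ≤ m) {h : Matrix (Fin 2) (Fin 2) ℤ} (hh : h ∈ Mmon) :
    gmat m * h ∈ Mmon := by
  rw [gmat_mul]
  right
  by_cases h1 : h = 1
  · subst h1
    simp
    omega
  · obtain ⟨hdet, ha, hab, hac, hbd, hcd, hb, hc⟩ := Mmon_entries hh h1
    simp only [Matrix.of_apply, Matrix.cons_val', Matrix.cons_val_zero, Matrix.cons_val_one,
      Matrix.cons_val_fin_one]
    refine ⟨?_, by nlinarith, hcd, by omega, by nlinarith, by nlinarith⟩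
    rcases hdet with h | h
    · right; linear_combination -h
    · left; linear_combination -h

lemma gmat_mul_inj {m m' : ℤ} {h h' : Matrix (Fin 2) (Fin 2) ℤ} (hh : h ∈ Mmon)
    (hh' : h' ∈ Mmon) (e : gmat m * h = gmat m' * h') : m = m' ∧ h = h' := by
  rw [gmat_mul, gmat_mul] at e
  have e00 := congrFun (congrFun e 0) 0
  have e01 := congrFun (congrFun e 0) 1
  have e10 := congrFun (congrFun e 1) 0
  have e11 := congrFun (congrFun e 1) 1
  simp only [Matrix.of_apply, Matrix.cons_val', Matrix.cons_val_zero, Matrix.cons_val_one,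
      Matrix.cons_val_fin_one] at e00 e01 e10 e11
  by_cases h1 : h = 1
  · by_cases h1' : h' = 1
    · subst h1 h1'
      simp at e11
      exact ⟨e11, rfl⟩
    · have := (Mmon_entries hh' h1').2.2.2.2.2.2.2
      subst h1
      simp at e00
      omega
  by_cases h1' : h' = 1
  · have := (Mmon_entries hh h1).2.2.2.2.2.2.2
    subst h1'
    simp at e00
    omega
  obtain ⟨hdet, ha, hab, hac, hbd, hcd, hb, hc⟩ := Mmon_entries hh h1
  obtain ⟨hdet', ha', hab', hac', hbd', hcd', hb', hc'⟩ := Mmon_entries hh' h1'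
  have hm : m = m' := by
    rcases lt_trichotomy m m' with hlt | heq | hlt
    · rw [← e01] at e11
      nlinarith
    · exact heq
    · rw [← e01] at e11
      nlinarith
  subst hm
  refine ⟨rfl, matrix_two_ext ?_ ?_ e00 e01⟩
  · rw [e00] at e10; omega
  · rw [e01] at e11; omega

lemma exists_gmat_mul {g : Matrix (Fin 2) (Fin 2) ℤ} (hg : g ∈ Mmon) (h1 : g ≠ 1) :
    ∃ m : ℤ, 1 ≤ m ∧ ∃ h ∈ Mmon, g = gmat m * h ∧ h 1 1 + h 1 0 < g 1 1 + g 1 0 := by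
  obtain ⟨hdet, ha, hab, hac, hbd, hcd, hb, hc⟩ := Mmon_entries hg h1
  have key : ∀ m : ℤ, 1 ≤ m →
      !![g 1 0 - m * g 0 0, g 1 1 - m * g 0 1; g 0 0, g 0 1] ∈ Mmon →
      g 0 1 + g 0 0 < g 1 1 + g 1 0 →
      ∃ m : ℤ, 1 ≤ m ∧ ∃ h ∈ Mmon, g = gmat m * h ∧ h 1 1 + h 1 0 < g 1 1 + g 1 0 := by
    intro m hm hM hlt
    refine ⟨m, hm, _, hM, ?_, by simpa using hlt⟩
    rw [gmat_mul]
    apply matrix_two_ext <;> simp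
  have hlt : g 0 1 + g 0 0 < g 1 1 + g 1 0 := by
    by_contra hcon
    have h2 : g 0 1 = g 1 1 := by omega
    have h3 : g 0 0 = g 1 0 := by omega
    rw [h2, h3] at hdet
    rcases hdet with h | h <;> nlinarith
  have mem : ∀ m : ℤ, 0 ≤ g 1 0 - m * g 0 0 → g 1 0 - m * g 0 0 ≤ g 0 0 →
      g 1 0 - m * g 0 0 ≤ g 1 1 - m * g 0 1 → g 1 1 - m * g 0 1 ≤ g 0 1 →
      !![g 1 0 - m * g 0 0, g 1 1 - m * g 0 1; g 0 0, g 0 1] ∈ Mmon := by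
    intro m i1 i2 i3 i4
    right
    simp only [Matrix.of_apply, Matrix.cons_val', Matrix.cons_val_zero, Matrix.cons_val_one,
      Matrix.cons_val_fin_one]
    refine ⟨?_, i4, i3, i1, hab, i2⟩
    rcases hdet with h | h
    · right; linear_combination -h
    · left; linear_combination -h
  generalize g 0 0 = a at *
  generalize g 0 1 = b at *
  generalize g 1 0 = c at *
  generalize g 1 1 = d at *
  obtain h0 | h0 | h0 : a = 0 ∨ a = 1 ∨ 2 ≤ a := by omega
  · subst h0
    have hbc : b = 1 ∧ c = 1 := by
      rcases hdet with h | h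
      · nlinarith
      · constructor <;> nlinarith
    obtain ⟨rfl, rfl⟩ := hbc
    refine key d hcd (Or.inl ?_) hlt
    apply matrix_two_ext <;> simp
  · subst h0
    rcases hdet with h | h
    · exact key c hc (mem c (by omega) (by omega) (by nlinarith) (by nlinarith)) hlt
    · have hb2 : 2 ≤ b := by
        by_contra hcon
        have : b = 1 := by omega
        subst this
        omega
      have hc2 : 2 ≤ c := by
        by_contra hcon
        have : c = 1 := by omega
        subst this
        omega
      exact key (c - 1) (by omega)
        (mem (c - 1) (by omega) (by omega) (by nlinarith) (by nlinarith)) hlt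
  · have e1 := Int.emod_add_mul_ediv c a
    have e2 := Int.emod_nonneg c (by omega : a ≠ 0)
    have e3 := Int.emod_lt_of_pos c (by omega : 0 < a)
    have e4 : 1 ≤ c / a := (Int.le_ediv_iff_mul_le (by omega)).2 (by omega)
    have e5 : c - c / a * a = c % a := by linarith
    set m := c / a
    set x := c % a
    have hdet' : x * b - (d - m * b) * a = 1 ∨ x * b - (d - m * b) * a = -1 := by
      rw [← e5]
      rcases hdet with h | h
      · right; linear_combination -h
      · left; linear_combination -h
    set y := d - m * b
    have hx : 1 ≤ x := by
      by_contra hcon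
      have : x = 0 := by omega
      rw [this] at hdet'
      have : a ∣ 1 := by
        rcases hdet' with h | h
        · exact ⟨-y, by linarith⟩
        · exact ⟨y, by linarith⟩
      have := Int.le_of_dvd one_pos this
      omega
    have hxy : x ≤ y := by
      by_contra hcon
      have : y ≤ x - 1 := by omega
      rcases hdet' with h | h <;> nlinarith
    have hyb : y ≤ b := by
      by_contra hcon
      have : b + 1 ≤ y := by omega
      rcases hdet' with h | h <;> nlinarith
    exact key m e4 (mem m (by omega) (by omega) (by omega) hyb) hlt

/-- The element `g(m₁ + 1) ⋯ g(m_r + 1)` of `ℳ` attached to the word `[m₁, …, m_r]`. -/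
def wordMat (l : List ℕ) : Matrix (Fin 2) (Fin 2) ℤ :=
  (l.map fun m : ℕ => gmat ((m : ℤ) + 1)).prod

@[simp] lemma wordMat_nil : wordMat [] = 1 := rfl

lemma wordMat_cons (m : ℕ) (l : List ℕ) : wordMat (m :: l) = gmat ((m : ℤ) + 1) * wordMat l := by
  simp [wordMat]

lemma wordMat_mem (l : List ℕ) : wordMat l ∈ Mmon := by
  induction l with
  | nil => exact Or.inl rfl
  | cons m l ih =>
    rw [wordMat_cons]
    exact gmat_mul_mem (by omega) ih

lemma wordMat_injective : Function.Injective wordMat := by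
  intro l
  induction l with
  | nil =>
    intro l' h
    cases l' with
    | nil => rfl
    | cons m l' =>
      rw [wordMat_cons] at h
      exact absurd h.symm (gmat_mul_ne_one (wordMat_mem l'))
  | cons m l ih =>
    intro l' h
    cases l' with
    | nil =>
      rw [wordMat_cons] at h
      exact absurd h (gmat_mul_ne_one (wordMat_mem l))
    | cons m' l' =>
      rw [wordMat_cons, wordMat_cons] at h
      obtain ⟨h1, h2⟩ := gmat_mul_inj (wordMat_mem l) (wordMat_mem l') h
      rw [ih h2]
      congr 1
      omega

lemma exists_wordMat_eq {g : Matrix (Fin 2) (Fin 2) ℤ} (hg : g ∈ Mmon) :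
    ∃ l, wordMat l = g := by
  obtain ⟨n, hn⟩ : ∃ n : ℕ, g 1 1 + g 1 0 ≤ n := ⟨(g 1 1 + g 1 0).toNat, Int.self_le_toNat _⟩
  induction n generalizing g with
  | zero =>
    have h1 := one_le_Mmon_one_one hg
    by_cases h : g = 1
    · exact ⟨[], h.symm⟩
    · have := (Mmon_entries hg h).2.2.2.2.2.2.2
      push_cast at hn
      omega
  | succ n ih =>
    by_cases h1 : g = 1
    · exact ⟨[], h1.symm⟩
    · obtain ⟨m, hm, h, hh, rfl, hlt⟩ := exists_gmat_mul hg h1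
      obtain ⟨l, rfl⟩ := ih hh (by push_cast at hn; omega)
      refine ⟨(m - 1).toNat :: l, ?_⟩
      rw [wordMat_cons]
      congr 2
      omega

/-- `ℳ` is the free monoid on the matrices `g(m)`, `m ≥ 1`. -/
noncomputable def wordEquiv : List ℕ ≃ Mmon :=
  Equiv.ofBijective (fun l => ⟨wordMat l, wordMat_mem l⟩)
    ⟨fun _ _ h => wordMat_injective (congrArg Subtype.val h),
      fun g => (exists_wordMat_eq g.2).imp fun _ h => Subtype.ext h⟩

lemma isOpen_cutPlane (a b : ℝ) : IsOpen (cutPlane a b) :=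
  (isCompact_Icc.image Complex.continuous_ofReal).isClosed.isOpen_compl

lemma ofReal_notMem_cutPlane {a b t : ℝ} (ht : t ∈ Icc a b) : (t : ℂ) ∉ cutPlane a b :=
  fun h => h ⟨t, ht, rfl⟩

lemma mem_cutPlane_of_re_neg {z : ℂ} (hz : z.re < 0) : z ∈ cutPlane 0 1 := by
  rintro ⟨t, ht, rfl⟩
  exact absurd ht.1 (by simpa using hz)

lemma mem_cutPlane_of_one_lt_norm {z : ℂ} (hz : 1 < ‖z‖) : z ∈ cutPlane 0 1 := by
  rintro ⟨t, ht, rfl⟩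
  rw [Complex.norm_real, Real.norm_eq_abs, abs_of_nonneg ht.1] at hz
  exact absurd ht.2 (by linarith)

lemma eventually_mem_cutPlane : ∀ᶠ z in Bornology.cobounded ℂ, z ∈ cutPlane 0 1 :=
  (tendsto_norm_cobounded_atTop.eventually_gt_atTop 1).mono
    fun _ hz => mem_cutPlane_of_one_lt_norm hz

lemma O1_congr {φ ψ : ℂ → ℂ} (hφ : φ ∈ O1 0 1) (h : EqOn ψ φ (cutPlane 0 1)) : ψ ∈ O1 0 1 :=
  ⟨hφ.1.congr h, hφ.2.congr' (eventually_mem_cutPlane.mono fun _ hz => (h hz).symm)⟩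

/-- A function of `𝒪¹` is bounded on the half-plane `re z ≤ -1/2`. -/
lemma O1_bounded {φ : ℂ → ℂ} (hφ : φ ∈ O1 0 1) :
    ∃ M : ℝ, 0 < M ∧ ∀ z : ℂ, z.re ≤ -(1 / 2) → ‖φ z‖ ≤ M := by
  have h1 : ∀ᶠ z in Bornology.cobounded ℂ, ‖φ z‖ < 1 := by
    have := hφ.2.norm
    rw [norm_zero] at this
    exact this.eventually_lt_const one_pos
  obtain ⟨r, -, hr⟩ := (Filter.hasBasis_cobounded_norm (E := ℂ)).eventually_iff.1 h1
  have hK : IsCompact (Metric.closedBall (0 : ℂ) r ∩ {z : ℂ | z.re ≤ -(1 / 2)}) :=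
    (isCompact_closedBall _ _).inter_right (isClosed_le Complex.continuous_re continuous_const)
  have hsub : Metric.closedBall (0 : ℂ) r ∩ {z : ℂ | z.re ≤ -(1 / 2)} ⊆ cutPlane 0 1 := by
    rintro z ⟨-, hz⟩
    refine mem_cutPlane_of_re_neg ?_
    have hz' : z.re ≤ -(1 / 2) := hz
    linarith
  obtain ⟨C, hC⟩ := hK.exists_bound_of_continuousOn (hφ.1.continuousOn.mono hsub)
  refine ⟨max C 1, by positivity, fun z hz => ?_⟩
  by_cases hzr : r ≤ ‖z‖
  · exact (hr hzr).le.trans (le_max_right _ _)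
  · exact (hC z ⟨by simpa using (not_le.1 hzr).le, hz⟩).trans (le_max_left _ _)

/-- Second-order Schwarz lemma: the first-order Taylor remainder of a bounded function. -/
lemma norm_taylor_le {f : ℂ → ℂ} {c z : ℂ} {r M : ℝ}
    (hd : DifferentiableOn ℂ f (Metric.ball c r)) (hM : ∀ w ∈ Metric.ball c r, ‖f w‖ ≤ M)
    (hz : z ∈ Metric.ball c r) :
    ‖f z - f c - (z - c) * deriv f c‖ ≤ 4 * M / r ^ 2 * ‖z - c‖ ^ 2 := by
  have hr : 0 < r := Metric.nonempty_ball.1 ⟨z, hz⟩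
  have hc : c ∈ Metric.ball c r := Metric.mem_ball_self hr
  have maps : MapsTo f (Metric.ball c r) (Metric.closedBall (f c) (2 * M)) := by
    intro w hw
    rw [mem_closedBall_iff_norm]
    linarith [norm_sub_le (f w) (f c), hM w hw, hM c hc]
  have hb : ∀ w ∈ Metric.ball c r, ‖dslope f c w‖ ≤ 2 * M / r := fun w hw =>
    Complex.norm_dslope_le_div_of_mapsTo_ball hd maps hw
  have maps' : MapsTo (dslope f c) (Metric.ball c r)
      (Metric.closedBall (dslope f c c) (4 * M / r)) := by
    intro w hw
    rw [mem_closedBall_iff_norm]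
    have e : 4 * M / r = 2 * M / r + 2 * M / r := by ring
    linarith [norm_sub_le (dslope f c w) (dslope f c c), hb w hw, hb c hc]
  have hd' : DifferentiableOn ℂ (dslope f c) (Metric.ball c r) :=
    (Complex.differentiableOn_dslope (Metric.ball_mem_nhds c hr)).2 hd
  have h := Complex.dist_le_div_mul_dist_of_mapsTo_ball hd' maps' hz
  rw [dist_eq_norm, dist_eq_norm, dslope_same] at h
  have e := sub_smul_dslope f c z
  rw [smul_eq_mul] at e
  rw [← e, ← mul_sub, norm_mul]
  calc ‖z - c‖ * ‖dslope f c z - deriv f c‖ ≤ ‖z - c‖ * (4 * M / r / r * ‖z - c‖) := by gcongr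
    _ = _ := by field_simp

section Entries

variable {g : Matrix (Fin 2) (Fin 2) ℤ}

lemma sub_mul_ne_zero (hg : g ∈ Mmon) (h1 : g ≠ 1) {z : ℂ} (hz : z ∈ cutPlane 0 1) :
    (g 0 0 : ℂ) - (g 1 0 : ℂ) * z ≠ 0 := by
  obtain ⟨-, ha, -, hac, -, -, -, hc⟩ := Mmon_entries hg h1
  intro h
  have hc' : (0 : ℝ) < g 1 0 := by exact_mod_cast hc
  have hcC : (g 1 0 : ℂ) ≠ 0 := by exact_mod_cast (by omega : g 1 0 ≠ 0)
  refine hz ⟨(g 0 0 : ℝ) / g 1 0, ⟨?_, ?_⟩, ?_⟩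
  · have : (0 : ℝ) ≤ g 0 0 := by exact_mod_cast ha
    positivity
  · rw [div_le_one hc']
    exact_mod_cast hac
  · push_cast
    rw [div_eq_iff hcC]
    linear_combination h

lemma moebius_mem_cutPlane (hg : g ∈ Mmon) (h1 : g ≠ 1) {z : ℂ} (hz : z ∈ cutPlane 0 1) :
    ((g 1 1 : ℂ) * z - (g 0 1 : ℂ)) / ((g 0 0 : ℂ) - (g 1 0 : ℂ) * z) ∈ cutPlane 0 1 := by
  have hne := sub_mul_ne_zero hg h1 hz
  obtain ⟨-, ha, hab, hac, hbd, hcd, hb, hc⟩ := Mmon_entries hg h1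
  have ha' : (0 : ℝ) ≤ g 0 0 := by exact_mod_cast ha
  have hac' : (g 0 0 : ℝ) ≤ g 1 0 := by exact_mod_cast hac
  have hbd' : (g 0 1 : ℝ) ≤ g 1 1 := by exact_mod_cast hbd
  have hb' : (1 : ℝ) ≤ g 0 1 := by exact_mod_cast hb
  have hc' : (1 : ℝ) ≤ g 1 0 := by exact_mod_cast hc
  rintro ⟨t, ⟨ht0, ht1⟩, ht⟩
  rw [eq_div_iff hne] at ht
  have hpos : (0 : ℝ) < g 1 1 + t * g 1 0 := by nlinarith
  refine hz ⟨(g 0 1 + t * g 0 0) / (g 1 1 + t * g 1 0), ⟨?_, ?_⟩, ?_⟩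
  · positivity
  · rw [div_le_one hpos]
    nlinarith
  · have hne' : (g 1 1 : ℂ) + t * g 1 0 ≠ 0 := by exact_mod_cast hpos.ne'
    push_cast
    rw [div_eq_iff hne']
    linear_combination ht

lemma neg_div_mem_cutPlane (hg : g ∈ Mmon) (h1 : g ≠ 1) :
    -(g 1 1 : ℂ) / (g 1 0 : ℂ) ∈ cutPlane 0 1 := by
  obtain ⟨-, -, -, -, -, hcd, -, hc⟩ := Mmon_entries hg h1
  have hc' : (1 : ℝ) ≤ g 1 0 := by exact_mod_cast hc
  have hcd' : (g 1 0 : ℝ) ≤ g 1 1 := by exact_mod_cast hcd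
  refine mem_cutPlane_of_re_neg ?_
  have : -(g 1 1 : ℂ) / (g 1 0 : ℂ) = ((-(g 1 1 : ℝ) / (g 1 0 : ℝ) : ℝ) : ℂ) := by push_cast; rfl
  rw [this, Complex.ofReal_re, neg_div, neg_lt_zero]
  have : (0 : ℝ) < g 1 1 := by linarith
  positivity

lemma Lop_of_ne_one (φ : ℂ → ℂ) (h1 : g ≠ 1) (z : ℂ) :
    Lop g φ z = ((g 0 0 : ℂ) - (g 1 0 : ℂ) * z) *
        (φ (((g 1 1 : ℂ) * z - (g 0 1 : ℂ)) / ((g 0 0 : ℂ) - (g 1 0 : ℂ) * z)) -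
          φ (-(g 1 1 : ℂ) / (g 1 0 : ℂ))) -
      ((g 0 0 * g 1 1 - g 0 1 * g 1 0 : ℤ) : ℂ) * ((g 1 0 : ℂ))⁻¹ *
        deriv φ (-(g 1 1 : ℂ) / (g 1 0 : ℂ)) :=
  if_neg h1

lemma differentiableOn_Lop {φ : ℂ → ℂ} (hφ : φ ∈ O1 0 1) (hg : g ∈ Mmon) :
    DifferentiableOn ℂ (Lop g φ) (cutPlane 0 1) := by
  by_cases h1 : g = 1
  · exact hφ.1.congr fun z _ => by simp [Lop, h1]
  have hmob : DifferentiableOn ℂ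
      (fun z : ℂ => ((g 1 1 : ℂ) * z - (g 0 1 : ℂ)) / ((g 0 0 : ℂ) - (g 1 0 : ℂ) * z))
      (cutPlane 0 1) :=
    DifferentiableOn.div (by fun_prop) (by fun_prop) fun z hz => sub_mul_ne_zero hg h1 hz
  have hcomp := hφ.1.comp hmob fun z hz => moebius_mem_cutPlane hg h1 hz
  have hj : DifferentiableOn ℂ (fun z : ℂ => (g 0 0 : ℂ) - (g 1 0 : ℂ) * z) (cutPlane 0 1) := by
    fun_prop
  exact ((hj.mul (hcomp.sub_const _)).sub_const _).congr fun z _ => Lop_of_ne_one φ h1 z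

lemma moebius_sub (hg : g ∈ Mmon) (h1 : g ≠ 1) {z : ℂ} (hz : z ∈ cutPlane 0 1) :
    ((g 1 1 : ℂ) * z - (g 0 1 : ℂ)) / ((g 0 0 : ℂ) - (g 1 0 : ℂ) * z) -
      -(g 1 1 : ℂ) / (g 1 0 : ℂ) = ((g 0 0 * g 1 1 - g 0 1 * g 1 0 : ℤ) : ℂ) /
        ((g 1 0 : ℂ) * ((g 0 0 : ℂ) - (g 1 0 : ℂ) * z)) := by
  have hne := sub_mul_ne_zero hg h1 hz
  have hc := (Mmon_entries hg h1).2.2.2.2.2.2.2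
  have hcC : (g 1 0 : ℂ) ≠ 0 := by exact_mod_cast (by omega : g 1 0 ≠ 0)
  rw [div_sub_div _ _ hne hcC, div_eq_div_iff (mul_ne_zero hne hcC) (mul_ne_zero hcC hne)]
  push_cast
  ring

/-- The main estimate on `L_g φ`, at distance `δ` from the cut. -/
lemma norm_Lop_le {φ : ℂ → ℂ} (hφ : φ ∈ O1 0 1) {M : ℝ}
    (hM : ∀ z : ℂ, z.re ≤ -(1 / 2) → ‖φ z‖ ≤ M) (hg : g ∈ Mmon) (h1 : g ≠ 1) {z : ℂ}
    {δ : ℝ} (hδ : 0 < δ) (hz : ∀ t ∈ Icc (0 : ℝ) 1, δ ≤ ‖z - t‖)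
    (hcd : 2 < g 1 0 * g 1 1 * δ) :
    ‖Lop g φ z‖ ≤ 16 * M / δ * ((g 1 0 : ℝ) * (g 1 1 : ℝ) ^ 2)⁻¹ := by
  have hzc : z ∈ cutPlane 0 1 := by
    rintro ⟨t, ht, rfl⟩
    have := hz t ht
    simp at this
    linarith
  have hsub := moebius_sub hg h1 hzc
  have hne := sub_mul_ne_zero hg h1 hzc
  have hLop := Lop_of_ne_one φ h1 z
  obtain ⟨hdet, ha, hab, hac, hbd, hcd', hb, hc⟩ := Mmon_entries hg h1
  have hc1 : (1 : ℝ) ≤ g 1 0 := by exact_mod_cast hc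
  have hcdR : (g 1 0 : ℝ) ≤ g 1 1 := by exact_mod_cast hcd'
  have haR : (0 : ℝ) ≤ g 0 0 := by exact_mod_cast ha
  have hacR : (g 0 0 : ℝ) ≤ g 1 0 := by exact_mod_cast hac
  have hcC : (g 1 0 : ℂ) ≠ 0 := by exact_mod_cast (by omega : g 1 0 ≠ 0)
  have hdetn : ‖((g 0 0 * g 1 1 - g 0 1 * g 1 0 : ℤ) : ℂ)‖ = 1 := by
    rcases hdet with h | h <;> rw [h] <;> simp
  have hnc : ‖(g 1 0 : ℂ)‖ = g 1 0 := by
    rw [Complex.norm_intCast, abs_of_nonneg (by linarith)]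
  have hj : (g 1 0 : ℝ) * δ ≤ ‖(g 0 0 : ℂ) - (g 1 0 : ℂ) * z‖ := by
    have := hz ((g 0 0 : ℝ) / g 1 0) ⟨by positivity, by rw [div_le_one (by linarith)]; exact hacR⟩
    have e : (g 0 0 : ℂ) - (g 1 0 : ℂ) * z =
        -((g 1 0 : ℂ) * (z - ((g 0 0 : ℝ) / g 1 0 : ℝ))) := by
      push_cast
      field_simp
      ring
    rw [e, norm_neg, norm_mul, hnc]
    gcongr
  set w := ((g 1 1 : ℂ) * z - (g 0 1 : ℂ)) / ((g 0 0 : ℂ) - (g 1 0 : ℂ) * z)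
  set w₀ : ℂ := -(g 1 1 : ℂ) / (g 1 0 : ℂ) with hw₀
  set ε := ((g 0 0 * g 1 1 - g 0 1 * g 1 0 : ℤ) : ℂ)
  set j := (g 0 0 : ℂ) - (g 1 0 : ℂ) * z
  have hw₀re : w₀.re = -((g 1 1 : ℝ) / g 1 0) := by
    have : w₀ = ((-((g 1 1 : ℝ) / g 1 0) : ℝ) : ℂ) := by rw [hw₀]; push_cast; ring
    rw [this, Complex.ofReal_re]
  generalize (g 1 0 : ℝ) = c at *
  generalize (g 1 1 : ℝ) = d at *
  have hjpos : 0 < ‖j‖ := norm_pos_iff.2 hne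
  have hdist : ‖w - w₀‖ = 1 / (c * ‖j‖) := by rw [hsub, norm_div, norm_mul, hdetn, hnc]
  have hcpos : 0 < c := by linarith
  have hdpos : 0 < d := by linarith
  have hball : ∀ u ∈ Metric.ball w₀ (d / (2 * c)), u.re ≤ -(1 / 2) := by
    intro u hu
    rw [mem_ball_iff_norm] at hu
    have h2 := (Complex.abs_re_le_norm (u - w₀)).trans_lt hu
    rw [Complex.sub_re, hw₀re] at h2
    have h3 := (abs_lt.1 h2).2
    have h4 : d / (2 * c) = d / c / 2 := by field_simp
    have h5 : 1 ≤ d / c := by rw [le_div_iff₀ hcpos]; linarith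
    rw [h4] at h3
    linarith
  have hwball : w ∈ Metric.ball w₀ (d / (2 * c)) := by
    rw [mem_ball_iff_norm, hdist, div_lt_div_iff₀ (by positivity) (by positivity)]
    have : d * (c * (c * δ)) ≤ d * (c * ‖j‖) := by gcongr
    nlinarith
  have key := norm_taylor_le (f := φ) (M := M)
    (hφ.1.mono fun u hu => mem_cutPlane_of_re_neg (by linarith [hball u hu]))
    (fun u hu => hM u (hball u hu)) hwball
  have e : Lop g φ z = j * (φ w - φ w₀ - (w - w₀) * deriv φ w₀) := by
    rw [hLop, hsub]
    field_simp
  have hM0 : 0 ≤ M := (norm_nonneg _).trans (hM (-1) (by norm_num))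
  rw [e, norm_mul]
  calc ‖j‖ * ‖φ w - φ w₀ - (w - w₀) * deriv φ w₀‖
      ≤ ‖j‖ * (4 * M / (d / (2 * c)) ^ 2 * ‖w - w₀‖ ^ 2) := by gcongr
    _ = 16 * M / (‖j‖ * d ^ 2) := by rw [hdist]; field_simp; ring
    _ ≤ 16 * M / (c * δ * d ^ 2) := by gcongr
    _ = _ := by field_simp

end Entries

/-- The summable weight on `ℳ` that dominates the operators `L_g`. -/
noncomputable def weight (g : Mmon) : ℝ :=
  |((g.1 1 0 : ℤ) : ℝ)| ^ (-(3 / 2) : ℝ) * |((g.1 1 1 : ℤ) : ℝ)| ^ (-(3 / 2) : ℝ)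

lemma Mmon_eq_of_lower_row {g h : Mmon} (hc : g.1 1 0 = h.1 1 0) (hd : g.1 1 1 = h.1 1 1)
    (hdet : g.1 0 0 * g.1 1 1 - g.1 0 1 * g.1 1 0 = h.1 0 0 * h.1 1 1 - h.1 0 1 * h.1 1 0) :
    g = h := by
  obtain ⟨g, hg⟩ := g
  obtain ⟨h, hh⟩ := h
  rw [Subtype.mk.injEq]
  dsimp only at hc hd hdet
  by_cases g1 : g = 1
  · by_cases h1 : h = 1
    · rw [g1, h1]
    · have := (Mmon_entries hh h1).2.2.2.2.2.2.2
      rw [g1] at hc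
      simp at hc
      omega
  by_cases h1 : h = 1
  · have := (Mmon_entries hg g1).2.2.2.2.2.2.2
    rw [h1] at hc
    simp at hc
    omega
  obtain ⟨e, ha, hab, hac, hbd, hcd, hb, hc1⟩ := Mmon_entries hg g1
  obtain ⟨e', ha', hab', hac', hbd', hcd', hb', hc1'⟩ := Mmon_entries hh h1
  have hdvd : (g 0 0 - h 0 0) * g 1 1 = (g 0 1 - h 0 1) * g 1 0 := by
    rw [← hc, ← hd] at hdet
    linear_combination hdet
  have hcop : IsCoprime (g 1 0) (g 1 1) := by
    rcases e with e | e
    · exact ⟨-g 0 1, g 0 0, by linear_combination e⟩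
    · exact ⟨g 0 1, -g 0 0, by linear_combination -e⟩
  obtain ⟨k, hk⟩ : g 1 0 ∣ g 0 0 - h 0 0 :=
    hcop.dvd_of_dvd_mul_right ⟨g 0 1 - h 0 1, by linear_combination hdvd⟩
  have hk' : g 0 1 - h 0 1 = g 1 1 * k := by
    rw [hk] at hdvd
    have : g 1 0 * (g 0 1 - h 0 1 - g 1 1 * k) = 0 := by linear_combination -hdvd
    rcases mul_eq_zero.1 this with h0 | h0
    · omega
    · linarith
  have hk0 : k = 0 := by
    rcases lt_trichotomy k 0 with hlt | heq | hlt
    · nlinarith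
    · exact heq
    · nlinarith
  rw [hk0] at hk hk'
  exact matrix_two_ext (by linarith) (by linarith) hc hd

lemma summable_weight : Summable weight := by
  have h1 : Summable fun n : ℤ => |(n : ℝ)| ^ (-(3 / 2) : ℝ) :=
    Real.summable_abs_int_rpow (by norm_num)
  have nn : ∀ n : ℤ, 0 ≤ |(n : ℝ)| ^ (-(3 / 2) : ℝ) := fun n => by positivity
  have h2 := (h1.mul_of_nonneg h1 nn nn)
  have h3 : Summable fun _ : Bool => (1 : ℝ) := (hasSum_fintype _).summable
  have h4 := h2.mul_of_nonneg h3 (fun p => mul_nonneg (nn _) (nn _)) (fun _ => zero_le_one)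
  let i : Mmon → (ℤ × ℤ) × Bool := fun g =>
    ((g.1 1 0, g.1 1 1), decide (g.1 0 0 * g.1 1 1 - g.1 0 1 * g.1 1 0 = 1))
  have hdet : ∀ g : Mmon, g.1 0 0 * g.1 1 1 - g.1 0 1 * g.1 1 0 = 1 ∨
      g.1 0 0 * g.1 1 1 - g.1 0 1 * g.1 1 0 = -1 := by
    intro g
    by_cases hg1 : g.1 = 1
    · left; simp [hg1]
    · exact (Mmon_entries g.2 hg1).1
  have hi : Function.Injective i := by
    intro g h e
    simp only [i, Prod.mk.injEq, decide_eq_decide] at e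
    refine Mmon_eq_of_lower_row e.1.1 e.1.2 ?_
    rcases hdet g with hg | hg <;> rcases hdet h with hh | hh <;> omega
  refine (h4.comp_injective hi).congr fun g => ?_
  simp [weight, i]

lemma inv_le_weight {g : Mmon} (h1 : g.1 ≠ 1) :
    ((g.1 1 0 : ℝ) * (g.1 1 1 : ℝ) ^ 2)⁻¹ ≤ weight g := by
  obtain ⟨-, -, -, -, -, hcd, -, hc⟩ := Mmon_entries g.2 h1
  have hc1 : (1 : ℝ) ≤ g.1 1 0 := by exact_mod_cast hc
  have hcdR : (g.1 1 0 : ℝ) ≤ g.1 1 1 := by exact_mod_cast hcd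
  unfold weight
  generalize (g.1 1 0 : ℝ) = c at *
  generalize (g.1 1 1 : ℝ) = d at *
  have hcpos : 0 < c := by linarith
  have hdpos : 0 < d := by linarith
  rw [abs_of_pos hcpos, abs_of_pos hdpos, Real.rpow_neg hcpos.le, Real.rpow_neg hdpos.le,
    ← mul_inv]
  have e1 : c ^ (3 / 2 : ℝ) = c * c ^ (1 / 2 : ℝ) := by
    rw [← Real.rpow_one_add' hcpos.le (by norm_num)]
    norm_num
  have e2 : d ^ 2 = d ^ (3 / 2 : ℝ) * d ^ (1 / 2 : ℝ) := by
    rw [← Real.rpow_add hdpos]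
    norm_num
  have e3 : c ^ (1 / 2 : ℝ) ≤ d ^ (1 / 2 : ℝ) := by gcongr
  refine inv_anti₀ (by positivity) ?_
  rw [e1, e2]
  calc c * c ^ (1 / 2 : ℝ) * d ^ (3 / 2 : ℝ) ≤ c * d ^ (1 / 2 : ℝ) * d ^ (3 / 2 : ℝ) := by gcongr
    _ = _ := by ring

lemma eventually_weight (δ : ℝ) (hδ : 0 < δ) :
    ∀ᶠ g : Mmon in cofinite, g.1 ≠ 1 ∧ 2 < (g.1 1 0 : ℝ) * g.1 1 1 * δ := by
  have h1 : ∀ᶠ g : Mmon in cofinite, g.1 ≠ 1 := by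
    refine (eventually_cofinite_ne (⟨1, Or.inl rfl⟩ : Mmon)).mono fun g hg h => hg (Subtype.ext h)
  have h2 := summable_weight.tendsto_cofinite_zero.eventually_lt_const
    (show (0 : ℝ) < (2 / δ) ^ (-(3 / 2) : ℝ) by positivity)
  filter_upwards [h1, h2] with g hg1 hg
  refine ⟨hg1, ?_⟩
  obtain ⟨-, -, -, -, -, hcd, -, hc⟩ := Mmon_entries g.2 hg1
  have hc1 : (0 : ℝ) < g.1 1 0 := by exact_mod_cast hc
  have hcdR : (0 : ℝ) < g.1 1 1 := by exact_mod_cast (by omega : 0 < g.1 1 1)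
  rw [weight, abs_of_pos hc1, abs_of_pos hcdR, ← Real.mul_rpow hc1.le hcdR.le] at hg
  by_contra hcon
  rw [not_lt, ← le_div_iff₀ hδ] at hcon
  exact absurd (Real.rpow_le_rpow_of_nonpos (by positivity) hcon (by norm_num)) (not_le.2 hg)

lemma exists_pos_le_norm_sub {K : Set ℂ} (hK : IsCompact K) (hKc : K ⊆ cutPlane 0 1) :
    ∃ δ : ℝ, 0 < δ ∧ ∀ z ∈ K, ∀ t ∈ Icc (0 : ℝ) 1, δ ≤ ‖z - t‖ := by
  obtain ⟨δ, hδ, h⟩ := hK.exists_thickening_subset_open (isOpen_cutPlane 0 1) hKc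
  refine ⟨δ, hδ, fun z hz t ht => ?_⟩
  by_contra hcon
  refine ofReal_notMem_cutPlane ht (h (Metric.mem_thickening_iff.2 ⟨z, hz, ?_⟩))
  rw [dist_comm, dist_eq_norm]
  exact not_le.1 hcon

/-- A family of holomorphic functions on the cut plane which is normally summable on compacts. -/
def NormallySummable {ι : Type*} (F : ι → ℂ → ℂ) : Prop :=
  (∀ i, DifferentiableOn ℂ (F i) (cutPlane 0 1)) ∧
    ∀ K : Set ℂ, IsCompact K → K ⊆ cutPlane 0 1 →
      ∃ u : ι → ℝ, Summable u ∧ ∀ i, ∀ z ∈ K, ‖F i z‖ ≤ u i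

lemma normallySummable_Lop {φ : ℂ → ℂ} (hφ : φ ∈ O1 0 1) :
    NormallySummable fun g : Mmon => Lop g.1 φ := by
  classical
  refine ⟨fun g => differentiableOn_Lop hφ g.2, fun K hK hKc => ?_⟩
  obtain ⟨δ, hδ, hz⟩ := exists_pos_le_norm_sub hK hKc
  obtain ⟨M, hM0, hM⟩ := O1_bounded hφ
  have hB : ∀ g : Mmon, ∃ B, ∀ z ∈ K, ‖Lop g.1 φ z‖ ≤ B := fun g =>
    hK.exists_bound_of_continuousOn ((differentiableOn_Lop hφ g.2).continuousOn.mono hKc)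
  choose B hB using hB
  refine ⟨fun g => if g.1 ≠ 1 ∧ 2 < (g.1 1 0 : ℝ) * g.1 1 1 * δ then
    16 * M / δ * weight g else B g, ?_, ?_⟩
  · refine (summable_congr_cofinite ?_).1 (summable_weight.mul_left (16 * M / δ))
    filter_upwards [eventually_weight δ hδ] with g hg
    rw [if_pos hg]
  · intro g z hzK
    dsimp only
    split_ifs with hg
    · refine (norm_Lop_le hφ hM g.2 hg.1 hδ (hz z hzK) hg.2).trans ?_
      gcongr
      exact inv_le_weight hg.1
    · exact hB g z hzK

namespace NormallySummable

variable {ι κ : Type*} {F : ι → ℂ → ℂ}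

lemma comp_injective (hF : NormallySummable F) {e : κ → ι} (he : Function.Injective e) :
    NormallySummable fun k => F (e k) := by
  refine ⟨fun k => hF.1 _, fun K hK hKc => ?_⟩
  obtain ⟨u, hu, h⟩ := hF.2 K hK hKc
  exact ⟨fun k => u (e k), hu.comp_injective he, fun k => h (e k)⟩

lemma summable (hF : NormallySummable F) {z : ℂ} (hz : z ∈ cutPlane 0 1) :
    Summable fun i => F i z := by
  obtain ⟨u, hu, h⟩ := hF.2 {z} isCompact_singleton (singleton_subset_iff.2 hz)
  exact hu.of_norm_bounded fun i => h i z rfl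

lemma exists_ball (hF : NormallySummable F) {z : ℂ} (hz : z ∈ cutPlane 0 1) :
    ∃ r > 0, Metric.ball z r ⊆ cutPlane 0 1 ∧
      ∃ u : ι → ℝ, Summable u ∧ ∀ i, ∀ w ∈ Metric.ball z r, ‖F i w‖ ≤ u i := by
  obtain ⟨r, hr, hsub⟩ := Metric.nhds_basis_closedBall.mem_iff.1
    ((isOpen_cutPlane 0 1).mem_nhds hz)
  obtain ⟨u, hu, h⟩ := hF.2 _ (isCompact_closedBall z r) hsub
  exact ⟨r, hr, Metric.ball_subset_closedBall.trans hsub, u, hu,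
    fun i w hw => h i w (Metric.ball_subset_closedBall hw)⟩

lemma differentiableOn_tsum (hF : NormallySummable F) :
    DifferentiableOn ℂ (fun z => ∑' i, F i z) (cutPlane 0 1) := by
  intro z hz
  obtain ⟨r, hr, hsub, u, hu, h⟩ := hF.exists_ball hz
  have := Complex.differentiableOn_tsum_of_summable_norm hu (fun i => (hF.1 i).mono hsub)
    Metric.isOpen_ball h
  exact (this.differentiableAt (Metric.ball_mem_nhds z hr)).differentiableWithinAt

lemma hasSum_deriv (hF : NormallySummable F) {z : ℂ} (hz : z ∈ cutPlane 0 1) :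
    HasSum (fun i => deriv (F i) z) (deriv (fun w => ∑' i, F i w) z) := by
  obtain ⟨r, hr, hsub, u, hu, h⟩ := hF.exists_ball hz
  exact Complex.hasSum_deriv_of_summable_norm hu (fun i => (hF.1 i).mono hsub)
    Metric.isOpen_ball h (Metric.mem_ball_self hr)

end NormallySummable

lemma tendsto_Lop_tsum {φ : ℂ → ℂ} (hφ : φ ∈ O1 0 1) {κ : Type*} {e : κ → Mmon}
    (he : Function.Injective e) :
    Tendsto (fun z => ∑' k, Lop (e k).1 φ z) (Bornology.cobounded ℂ) (nhds 0) := by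
  classical
  obtain ⟨M, hM0, hM⟩ := O1_bounded hφ
  have hδ : ∀ z : ℂ, ∀ t ∈ Icc (0 : ℝ) 1, ‖z‖ - 1 ≤ ‖z - t‖ := by
    intro z t ht
    have h1 := norm_sub_norm_le z (t : ℂ)
    rw [Complex.norm_real, Real.norm_eq_abs, abs_of_nonneg ht.1] at h1
    linarith [ht.2]
  have hcd : ∀ g : Mmon, g.1 ≠ 1 → ∀ z : ℂ, 4 < ‖z‖ →
      2 < (g.1 1 0 : ℝ) * g.1 1 1 * (‖z‖ - 1) := by
    intro g hg z hz
    obtain ⟨-, -, -, -, -, h, -, hc⟩ := Mmon_entries g.2 hg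
    have hc1 : (1 : ℝ) ≤ g.1 1 0 := by exact_mod_cast hc
    have hd1 : (1 : ℝ) ≤ g.1 1 1 := by exact_mod_cast hc.trans h
    have : (1 : ℝ) ≤ g.1 1 0 * g.1 1 1 := by nlinarith
    nlinarith
  have hb : ∀ g : Mmon, g.1 ≠ 1 → ∀ z : ℂ, 4 < ‖z‖ →
      ‖Lop g.1 φ z‖ ≤ 16 * M / (‖z‖ - 1) * weight g := by
    intro g hg z hz
    have h3 : 0 < ‖z‖ - 1 := by linarith
    refine (norm_Lop_le hφ hM g.2 hg h3 (hδ z) (hcd g hg z hz)).trans ?_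
    gcongr
    exact inv_le_weight hg
  have hev := tendsto_norm_cobounded_atTop (E := ℂ) |>.eventually_gt_atTop 4
  have hw : ∀ g, 0 ≤ weight g := fun g => by unfold weight; positivity
  have hone : ∀ g : Mmon, g.1 = 1 → Lop g.1 φ = φ := fun g hg => by
    funext z
    simp [Lop, hg]
  have h1 : ∀ᶠ z in Bornology.cobounded ℂ, ‖φ z‖ < 1 := by
    have := hφ.2.norm
    rw [norm_zero] at this
    exact this.eventually_lt_const one_pos
  have hsum : Summable fun g : Mmon => if g.1 = 1 then 1 else 16 * M / 3 * weight g := by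
    refine (summable_congr_cofinite ?_).1 (summable_weight.mul_left (16 * M / 3))
    filter_upwards [eventually_weight 1 one_pos] with g hg
    rw [if_neg hg.1]
  have key := tendsto_tsum_of_dominated_convergence (𝓕 := Bornology.cobounded ℂ)
    (f := fun z k => Lop (e k).1 φ z) (g := fun _ => 0) (hsum.comp_injective he) ?_ ?_
  · simpa using key
  · intro k
    by_cases hg : (e k).1 = 1
    · rw [hone _ hg]
      exact hφ.2
    · refine squeeze_zero_norm' (hev.mono fun z hz => hb (e k) hg z hz) ?_
      have : Tendsto (fun z : ℂ => ‖z‖ - 1) (Bornology.cobounded ℂ) atTop :=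
        tendsto_atTop_add_const_right _ (-1) tendsto_norm_cobounded_atTop
      simpa using (this.const_div_atTop (16 * M)).mul_const (weight (e k))
  · filter_upwards [hev, h1] with z hz hz1 k
    simp only [Function.comp_apply]
    split_ifs with hg
    · rw [hone _ hg]
      exact hz1.le
    · refine (hb (e k) hg z hz).trans ?_
      have := hw (e k)
      gcongr
      linarith

lemma Lop_tsum_mem_O1 {φ : ℂ → ℂ} (hφ : φ ∈ O1 0 1) {κ : Type*} {e : κ → Mmon}
    (he : Function.Injective e) : (fun z => ∑' k, Lop (e k).1 φ z) ∈ O1 0 1 :=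
  ⟨((normallySummable_Lop hφ).comp_injective he).differentiableOn_tsum, tendsto_Lop_tsum hφ he⟩

lemma neg_natCast_mem_cutPlane (m : ℕ) : -((m : ℂ) + 1) ∈ cutPlane 0 1 := by
  refine mem_cutPlane_of_re_neg ?_
  simp
  linarith [Nat.cast_nonneg (α := ℝ) m]

lemma ne_zero_of_mem_cutPlane {z : ℂ} (hz : z ∈ cutPlane 0 1) : z ≠ 0 := by
  rintro rfl
  exact hz ⟨0, by simp, by simp⟩

lemma inv_sub_mem_cutPlane (m : ℕ) {z : ℂ} (hz : z ∈ cutPlane 0 1) :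
    z⁻¹ - ((m : ℂ) + 1) ∈ cutPlane 0 1 := by
  have hz0 := ne_zero_of_mem_cutPlane hz
  have h := moebius_mem_cutPlane (gmat_mul_mem (m := (m : ℤ) + 1) (by omega) (Or.inl rfl))
    (gmat_mul_ne_one (Or.inl rfl)) hz
  convert h using 1
  simp [gmat]
  field_simp
  ring

lemma Tterm_congr {φ ψ : ℂ → ℂ} (h : EqOn φ ψ (cutPlane 0 1)) (m : ℕ) {z : ℂ}
    (hz : z ∈ cutPlane 0 1) : Tterm φ m z = Tterm ψ m z := by
  have hm := neg_natCast_mem_cutPlane m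
  have hd : deriv φ (-((m : ℂ) + 1)) = deriv ψ (-((m : ℂ) + 1)) :=
    (h.eventuallyEq_of_mem ((isOpen_cutPlane 0 1).mem_nhds hm)).deriv_eq
  simp only [Tterm, h (inv_sub_mem_cutPlane m hz), h hm, hd]

lemma Tbrj_congr {φ ψ : ℂ → ℂ} (h : EqOn φ ψ (cutPlane 0 1)) {z : ℂ}
    (hz : z ∈ cutPlane 0 1) : Tbrj φ z = Tbrj ψ z :=
  tsum_congr fun m => Tterm_congr h m hz

lemma Tterm_tsum {ι : Type*} {F : ι → ℂ → ℂ} (hF : NormallySummable F) (m : ℕ) {z : ℂ}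
    (hz : z ∈ cutPlane 0 1) :
    Tterm (fun w => ∑' i, F i w) m z = ∑' i, Tterm (F i) m z := by
  have hm := neg_natCast_mem_cutPlane m
  have h1 := (hF.summable (inv_sub_mem_cutPlane m hz)).hasSum
  have h2 := (hF.summable hm).hasSum
  exact (((h1.sub h2).mul_left (-z)).add (hF.hasSum_deriv hm)).tsum_eq.symm

lemma Lop_one (φ : ℂ → ℂ) : Lop 1 φ = φ := by
  funext z
  simp [Lop]

/-- `L_{g(m)} L_h = L_{g(m) h}`. -/
lemma Tterm_Lop {φ : ℂ → ℂ} (hφ : φ ∈ O1 0 1) {h : Matrix (Fin 2) (Fin 2) ℤ} (hh : h ∈ Mmon)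
    (m : ℕ) {z : ℂ} (hz : z ∈ cutPlane 0 1) :
    Tterm (Lop h φ) m z = Lop (gmat ((m : ℤ) + 1) * h) φ z := by
  have hz0 := ne_zero_of_mem_cutPlane hz
  have hne := gmat_mul_ne_one (m := (m : ℤ) + 1) hh
  have hmem := gmat_mul_mem (m := (m : ℤ) + 1) (by omega) hh
  rw [Lop_of_ne_one φ hne]
  by_cases h1 : h = 1
  · subst h1
    rw [Lop_one, mul_one]
    have e : z⁻¹ - ((m : ℂ) + 1) = (((m : ℂ) + 1) * z - 1) / (0 - 1 * z) := by
      field_simp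
      ring
    simp only [Tterm, e]
    simp [gmat]
  have hj := sub_mul_ne_zero hmem hne hz
  have hw := moebius_mem_cutPlane hmem hne hz
  have hw₀ := neg_div_mem_cutPlane hmem hne
  have hm := neg_natCast_mem_cutPlane m
  have hjm := sub_mul_ne_zero hh h1 hm
  have hju := sub_mul_ne_zero hh h1 (inv_sub_mem_cutPlane m hz)
  have hc := (Mmon_entries hh h1).2.2.2.2.2.2.2
  have hcC : (h 1 0 : ℂ) ≠ 0 := by exact_mod_cast (by omega : h 1 0 ≠ 0)
  rw [gmat_mul] at *
  simp only [Matrix.of_apply, Matrix.cons_val', Matrix.cons_val_zero, Matrix.cons_val_one,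
      Matrix.cons_val_fin_one] at *
  push_cast at *
  have hc' : (h 0 0 : ℂ) + ((m : ℂ) + 1) * h 1 0 ≠ 0 := by
    intro h0; apply hjm; linear_combination h0
  have e0 : ((h 1 1 : ℂ) * -((m : ℂ) + 1) - h 0 1) / ((h 0 0 : ℂ) - h 1 0 * -((m : ℂ) + 1)) =
      -((h 0 1 : ℂ) + ((m : ℂ) + 1) * h 1 1) / ((h 0 0 : ℂ) + ((m : ℂ) + 1) * h 1 0) := by
    congr 1 <;> ring
  have e1 : ((h 1 1 : ℂ) * (z⁻¹ - ((m : ℂ) + 1)) - h 0 1) /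
      ((h 0 0 : ℂ) - h 1 0 * (z⁻¹ - ((m : ℂ) + 1))) =
      (((h 0 1 : ℂ) + ((m : ℂ) + 1) * h 1 1) * z - h 1 1) /
        ((h 1 0 : ℂ) - ((h 0 0 : ℂ) + ((m : ℂ) + 1) * h 1 0) * z) := by
    rw [div_eq_div_iff hju hj]
    field_simp
    ring
  set W := φ (-(h 1 1 : ℂ) / (h 1 0 : ℂ)) with hW
  set V := deriv φ (-(h 1 1 : ℂ) / (h 1 0 : ℂ)) with hV
  have hderiv : HasDerivAt (Lop h φ)
      (-(h 1 0 : ℂ) * (φ (-((h 0 1 : ℂ) + ((m : ℂ) + 1) * h 1 1) /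
        ((h 0 0 : ℂ) + ((m : ℂ) + 1) * h 1 0)) - W) +
        ((h 0 0 : ℂ) - h 1 0 * -((m : ℂ) + 1)) *
        (deriv φ (-((h 0 1 : ℂ) + ((m : ℂ) + 1) * h 1 1) /
          ((h 0 0 : ℂ) + ((m : ℂ) + 1) * h 1 0)) *
          (((h 1 1 : ℂ) * ((h 0 0 : ℂ) - h 1 0 * -((m : ℂ) + 1)) -
            ((h 1 1 : ℂ) * -((m : ℂ) + 1) - h 0 1) * (-(h 1 0 : ℂ))) /
            ((h 0 0 : ℂ) - h 1 0 * -((m : ℂ) + 1)) ^ 2))) (-((m : ℂ) + 1)) := by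
    have d1 : HasDerivAt (fun w : ℂ => (h 0 0 : ℂ) - h 1 0 * w) (-(h 1 0 : ℂ))
        (-((m : ℂ) + 1)) := by
      simpa using ((hasDerivAt_id (-((m : ℂ) + 1))).const_mul (h 1 0 : ℂ)).const_sub (h 0 0 : ℂ)
    have d2 : HasDerivAt (fun w : ℂ => (h 1 1 : ℂ) * w - h 0 1) (h 1 1 : ℂ)
        (-((m : ℂ) + 1)) := by
      simpa using ((hasDerivAt_id (-((m : ℂ) + 1))).const_mul (h 1 1 : ℂ)).sub_const (h 0 1 : ℂ)
    have d3 := d2.div d1 hjm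
    have d4 := (hφ.1.differentiableAt ((isOpen_cutPlane 0 1).mem_nhds hw₀)).hasDerivAt
    rw [← e0] at d4
    have d5 := HasDerivAt.comp (h₂ := φ) (-((m : ℂ) + 1)) d4 d3
    have d6 := (d1.mul (d5.sub_const W)).sub_const
      (((h 0 0 * h 1 1 - h 0 1 * h 1 0 : ℤ) : ℂ) * ((h 1 0 : ℂ))⁻¹ * V)
    rw [← e0]
    refine (d6.congr_of_eventuallyEq (Eventually.of_forall fun w => ?_))
    exact Lop_of_ne_one φ h1 w
  rw [Tterm, hderiv.deriv, Lop_of_ne_one φ h1, Lop_of_ne_one φ h1, e0, e1, ← hW, ← hV]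
  generalize φ (-((h 0 1 : ℂ) + ((m : ℂ) + 1) * h 1 1) /
        ((h 0 0 : ℂ) + ((m : ℂ) + 1) * h 1 0)) = Y
  generalize deriv φ (-((h 0 1 : ℂ) + ((m : ℂ) + 1) * h 1 1) /
        ((h 0 0 : ℂ) + ((m : ℂ) + 1) * h 1 0)) = Z
  generalize φ ((((h 0 1 : ℂ) + ((m : ℂ) + 1) * h 1 1) * z - h 1 1) /
        ((h 1 0 : ℂ) - ((h 0 0 : ℂ) + ((m : ℂ) + 1) * h 1 0) * z)) = X
  have e2 : (h 0 0 : ℂ) - h 1 0 * -((m : ℂ) + 1) = (h 0 0 : ℂ) + ((m : ℂ) + 1) * h 1 0 := by ring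
  rw [e2]
  generalize (m : ℂ) + 1 = n at *
  field_simp
  ring

lemma Lop_sub {φ ψ : ℂ → ℂ} (hφ : φ ∈ O1 0 1) (hψ : ψ ∈ O1 0 1)
    {g : Matrix (Fin 2) (Fin 2) ℤ} (hg : g ∈ Mmon) (z : ℂ) :
    Lop g (fun w => φ w - ψ w) z = Lop g φ z - Lop g ψ z := by
  by_cases h1 : g = 1
  · simp [h1, Lop_one]
  have hw := (isOpen_cutPlane 0 1).mem_nhds (neg_div_mem_cutPlane hg h1)
  rw [Lop_of_ne_one _ h1, Lop_of_ne_one _ h1, Lop_of_ne_one _ h1,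
    deriv_fun_sub (hφ.1.differentiableAt hw) (hψ.1.differentiableAt hw)]
  ring

lemma normallySummable_wordMat {φ : ℂ → ℂ} (hφ : φ ∈ O1 0 1) :
    NormallySummable fun l => Lop (wordMat l) φ :=
  (normallySummable_Lop hφ).comp_injective wordEquiv.injective

lemma sumM_eq_tsum_words (φ : ℂ → ℂ) (z : ℂ) : sumM φ z = ∑' l, Lop (wordMat l) φ z :=
  (wordEquiv.tsum_eq fun g : Mmon => Lop g.1 φ z).symm

lemma Tbrj_tsum_wordMat {φ : ℂ → ℂ} (hφ : φ ∈ O1 0 1) {κ : Type*} {e : κ → List ℕ}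
    (he : Function.Injective e) {z : ℂ} (hz : z ∈ cutPlane 0 1) :
    Tbrj (fun w => ∑' k, Lop (wordMat (e k)) φ w) z =
      ∑' p : ℕ × κ, Lop (wordMat (p.1 :: e p.2)) φ z := by
  have hF := normallySummable_wordMat hφ
  have hinj : Function.Injective fun p : ℕ × κ => p.1 :: e p.2 := by
    rintro ⟨m, k⟩ ⟨m', k'⟩ h
    simp only [List.cons.injEq] at h
    exact Prod.ext h.1 (he h.2)
  rw [((hF.comp_injective hinj).summable hz).tsum_prod]
  refine tsum_congr fun m => ?_
  rw [Tterm_tsum (hF.comp_injective he) m hz]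
  refine tsum_congr fun k => ?_
  rw [Tterm_Lop hφ (wordMat_mem _) m hz, wordMat_cons]

/-- Splitting a word of length `r + 1` into its first letter and the remaining word. -/
def consLengthEquiv (r : ℕ) :
    ℕ × (List.length ⁻¹' {r} : Set (List ℕ)) ≃ (List.length ⁻¹' {r + 1} : Set (List ℕ)) where
  toFun p := ⟨p.1 :: p.2.1, congrArg Nat.succ p.2.2⟩
  invFun
    | ⟨[], h⟩ => absurd h (Nat.succ_ne_zero r).symm
    | ⟨m :: l, h⟩ => (m, ⟨l, Nat.succ_injective h⟩)
  left_inv _ := rfl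
  right_inv
    | ⟨[], h⟩ => absurd h (Nat.succ_ne_zero r).symm
    | ⟨_ :: _, _⟩ => rfl

lemma iterate_Tbrj_eq {φ : ℂ → ℂ} (hφ : φ ∈ O1 0 1) (r : ℕ) :
    EqOn (Tbrj^[r] φ)
      (fun z => ∑' l : (List.length ⁻¹' {r} : Set (List ℕ)), Lop (wordMat l) φ z)
      (cutPlane 0 1) := by
  induction r with
  | zero =>
    intro z _
    have : (List.length ⁻¹' {0} : Set (List ℕ)) = {[]} := by
      ext l
      simp
    dsimp only
    rw [this, tsum_singleton ([] : List ℕ) fun l => Lop (wordMat l) φ z]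
    simp [Lop_one]
  | succ r ih =>
    intro z hz
    rw [Function.iterate_succ_apply', Tbrj_congr ih hz,
      Tbrj_tsum_wordMat hφ Subtype.val_injective hz]
    exact (consLengthEquiv r).tsum_eq
      fun l : (List.length ⁻¹' {r + 1} : Set (List ℕ)) => Lop (wordMat l) φ z

lemma hasSum_iterate_Tbrj {φ : ℂ → ℂ} (hφ : φ ∈ O1 0 1) {z : ℂ} (hz : z ∈ cutPlane 0 1) :
    HasSum (fun r : ℕ => (Tbrj^[r] φ) z) (sumM φ z) := by
  rw [sumM_eq_tsum_words]
  have h := ((normallySummable_wordMat hφ).summable hz).hasSum.tsum_fiberwise List.length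
  exact h.congr_fun fun r => iterate_Tbrj_eq hφ r hz

lemma Tbrj_mem_O1 {φ : ℂ → ℂ} (hφ : φ ∈ O1 0 1) : Tbrj φ ∈ O1 0 1 :=
  O1_congr (Lop_tsum_mem_O1 hφ (wordEquiv.injective.comp Subtype.val_injective))
    (iterate_Tbrj_eq hφ 1)

/-- Splitting a sum over words according to the first letter. -/
lemma tsum_list_eq_add_tsum_cons {f : List ℕ → ℂ} (hf : Summable f) :
    ∑' l, f l = f [] + ∑' p : ℕ × List ℕ, f (p.1 :: p.2) := by
  have hinj : Function.Injective fun p : ℕ × List ℕ => p.1 :: p.2 := by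
    rintro ⟨m, l⟩ ⟨m', l'⟩ h
    simpa using h
  rw [hf.tsum_eq_add_tsum_ite [], ← hinj.tsum_eq]
  · simp
  · intro l hl
    cases l with
    | nil => simp at hl
    | cons m l => exact ⟨(m, l), rfl⟩

/-- summability of the family `(L_g φ)_{g ∈ ℳ}`, uniformly on compact
subsets of `ℂ∖[0,1]`, with sum `Σ_ℳ φ ∈ 𝒪¹(ℂ̄∖[0,1])`; `Σ_ℳ φ = Σ_{r≥0} T^r φ`; and
`Σ_ℳ` and `1 − T` are mutually inverse on `𝒪¹(ℂ̄∖[0,1])`. -/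
theorem sumM_properties :
    ∀ φ ∈ O1 0 1,
      (∀ K : Set ℂ, IsCompact K → K ⊆ cutPlane 0 1 →
        Summable (fun g : Mmon => ⨆ z ∈ K, ‖Lop g.1 φ z‖)) ∧
      sumM φ ∈ O1 0 1 ∧
      (∀ z ∈ cutPlane 0 1,
        Summable (fun r : ℕ => (Tbrj^[r] φ) z) ∧
          sumM φ z = ∑' r : ℕ, (Tbrj^[r] φ) z) ∧
      (∀ z ∈ cutPlane 0 1, sumM φ z - Tbrj (sumM φ) z = φ z) ∧
      ∀ z ∈ cutPlane 0 1, sumM (fun w => φ w - Tbrj φ w) z = φ z := by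
  intro φ hφ
  have hT := Tbrj_mem_O1 hφ
  have hS := sumM_eq_tsum_words φ
  have hF := normallySummable_wordMat hφ
  have hSO : sumM φ ∈ O1 0 1 := Lop_tsum_mem_O1 hφ (e := id) Function.injective_id
  refine ⟨fun K hK hKc => ?_, hSO, fun z hz => ?_, fun z hz => ?_, fun z hz => ?_⟩
  · obtain ⟨u, hu, h⟩ := (normallySummable_Lop hφ).2 K hK hKc
    refine hu.abs.of_nonneg_of_le (fun g => ?_) (fun g => ?_)
    · exact Real.iSup_nonneg fun z => Real.iSup_nonneg fun _ => norm_nonneg _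
    · exact Real.iSup_le (fun z => Real.iSup_le (fun hz => (h g z hz).trans (le_abs_self _))
        (abs_nonneg _)) (abs_nonneg _)
  · have h := hasSum_iterate_Tbrj hφ hz
    exact ⟨h.summable, h.tsum_eq.symm⟩
  · have h1 := Tbrj_tsum_wordMat hφ (e := id) Function.injective_id hz
    have h2 : Tbrj (sumM φ) z = ∑' p : ℕ × List ℕ, Lop (wordMat (p.1 :: p.2)) φ z := by
      exact (Tbrj_congr (fun w _ => hS w) hz).trans h1
    have h3 := tsum_list_eq_add_tsum_cons (hF.summable hz)
    rw [h2, hS z, h3]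
    simp [Lop_one]
  · have hadd : sumM (fun w => φ w - Tbrj φ w) z = sumM φ z - sumM (Tbrj φ) z := by
      unfold sumM
      rw [← ((normallySummable_Lop hφ).summable hz).tsum_sub
        ((normallySummable_Lop hT).summable hz)]
      exact tsum_congr fun g => Lop_sub hφ hT g.2 z
    have h1 := hasSum_iterate_Tbrj hφ hz
    have h2 := hasSum_iterate_Tbrj hT hz
    rw [hadd, ← h1.tsum_eq, ← h2.tsum_eq, h1.summable.tsum_eq_zero_add]
    simp
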